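/- arXiv:2201.09412 — 2 statements merged into one kernel-verified Lean document; each statement's English description precedes it below -/
import Mathlib

section
/- For any real n × m matrix F, the pseudo determinant of F^T F equals the sum over all subsets P of rows of size k = rank(F) of det(F_P)^2, where F_P is the square submatrix of F with rows indexed by P. -/
open Matrix

/-- The pseudo determinant of a real square matrix: the product of its nonzero
eigenvalues, computed as `(-1)^rank` times the lowest-order nonzero coefficient
of the characteristic polynomial. -/
noncomputable def pseudoDet {V : Type*} [Fintype V] [DecidableEq V]
    (A : Matrix V V ℝ) : ℝ :=
  (-1 : ℝ) ^ A.rank * A.charpoly.coeff (Fintype.card V - A.rank)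

/-- Sum-of-principal-minors form of Cauchy-Binet. -/
lemma det_transpose_mul_self_eq_sum_aux {n κ : Type*} [Fintype n] [DecidableEq n]
    [Fintype κ] [DecidableEq κ] (A : Matrix n κ ℝ) (k : ℕ)
    (hk : Fintype.card κ = k) :
    (Aᵀ * A).det = ∑ s ∈ Finset.univ.powersetCard k,
      ((A * Aᵀ).submatrix (Subtype.val : s → n) (Subtype.val : s → n)).det := by
  subst hk
  rw [← coeff_det_one_add_X_smul_eq_sum_minors (A * Aᵀ)]
  have h : (1 + (Polynomial.X : Polynomial ℝ) • (A * Aᵀ).map Polynomial.C).det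
      = (1 + (Polynomial.X : Polynomial ℝ) • (Aᵀ * A).map Polynomial.C).det := by
    rw [Matrix.map_mul, Matrix.map_mul, ← Matrix.smul_mul, det_one_add_mul_comm, Matrix.mul_smul]
  rw [h, coeff_det_one_add_X_smul_eq_sum_minors (Aᵀ * A), ← Finset.card_univ, Finset.powersetCard_self,
    Finset.sum_singleton]
  generalize Aᵀ * A = M
  let e : {x // x ∈ (Finset.univ : Finset κ)} ≃ κ :=
    Equiv.subtypeUnivEquiv (fun x => Finset.mem_univ x)
  have he : (Subtype.val : {x // x ∈ (Finset.univ : Finset κ)} → κ) = e := rfl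
  rw [he]
  convert (det_submatrix_equiv_self e M).symm

lemma det_mul_transpose_eq_sq_aux {k : ℕ} {p q : Type*} [Fintype p] [DecidableEq p]
    [Fintype q] [DecidableEq q] (G : Matrix p q ℝ) (e : Fin k ≃ p) (f : Fin k ≃ q) :
    (G * Gᵀ).det = (G.submatrix e f).det ^ 2 := by
  rw [← det_submatrix_equiv_self e, ← submatrix_mul_equiv G Gᵀ e f e, det_mul,
    ← transpose_submatrix, det_transpose, sq]

/-- Pythagorean Cauchy–Binet identity for pseudo determinants:
for any real `n × m` matrix `F`, the pseudo determinant of `Fᵀ F` is the sum,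
over all square submatrices `F_{P,Q}` of `F` of size `k = rank F` (rows indexed
by a subset `P` of rows, columns by a subset `Q` of columns, each of size `k`),
of `det(F_{P,Q})²`. -/
theorem pseudoDet_transpose_mul_self_eq_sum_sq_minors {n m : ℕ}
    (F : Matrix (Fin n) (Fin m) ℝ) :
    pseudoDet (Fᵀ * F) =
      ∑ P ∈ (Finset.univ.powersetCard F.rank : Finset (Finset (Fin n))).attach,
        ∑ Q ∈ (Finset.univ.powersetCard F.rank : Finset (Finset (Fin m))).attach,
          (Matrix.det (F.submatrix
            (fun i => ((P.1.orderIsoOfFin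
              (Finset.mem_powersetCard.mp P.2).2 i : P.1) : Fin n))
            (fun j => ((Q.1.orderIsoOfFin
              (Finset.mem_powersetCard.mp Q.2).2 j : Q.1) : Fin m)))) ^ 2 := by
  have hk : F.rank ≤ Fintype.card (Fin m) := by
    simpa using F.rank_le_width
  rw [pseudoDet, rank_transpose_mul_self, charpoly_coeff_eq_sum_minors _ _ hk, ← mul_assoc,
    ← mul_pow, neg_one_mul, neg_neg, one_pow, one_mul, Finset.sum_comm, ← Finset.sum_attach]
  refine Finset.sum_congr rfl fun Q _ => ?_
  have hQ := (Finset.mem_powersetCard.mp Q.2).2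
  have h1 : (Fᵀ * F).submatrix (Subtype.val : Q.1 → Fin m) (Subtype.val : Q.1 → Fin m)
      = (F.submatrix id (Subtype.val : Q.1 → Fin m))ᵀ
        * F.submatrix id (Subtype.val : Q.1 → Fin m) := by
    ext i j
    simp [Matrix.mul_apply]
  rw [h1, det_transpose_mul_self_eq_sum_aux _ F.rank (by rw [Fintype.card_coe, hQ]), ← Finset.sum_attach]
  refine Finset.sum_congr rfl fun P _ => ?_
  have hP := (Finset.mem_powersetCard.mp P.2).2
  exact det_mul_transpose_eq_sq_aux
    (F.submatrix (Subtype.val : P.1 → Fin n) (Subtype.val : Q.1 → Fin m))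
    (P.1.orderIsoOfFin hP).toEquiv (Q.1.orderIsoOfFin hQ).toEquiv
end

section
/- For the complete graph K_n (n ≥ 1), the squared analytic torsion satisfies A(K_n) = n. -/
open Matrix

/-- The `k`-dimensional simplices of the Whitney complex of the complete graph
`K n`: subsets of `{1,…,n}` of cardinality `k+1`. -/
def CompleteSimplex (n k : ℕ) := {s : Finset (Fin n) // s.card = k + 1}

instance (n k : ℕ) : Fintype (CompleteSimplex n k) := by
  unfold CompleteSimplex; infer_instance

instance (n k : ℕ) : DecidableEq (CompleteSimplex n k) := by
  unfold CompleteSimplex; infer_instance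

/-- The signed incidence matrix (exterior derivative) `d_k` from `k`-forms to
`(k+1)`-forms of the Whitney complex of `K n`, with simplices ordered by the
natural order on `Fin n`: the entry at `(s, t)` with `t ⊆ s` is `(-1)^i` where
`i` is the position in `s` of the vertex missing from `t`. -/
def completeD (n k : ℕ) :
    Matrix (CompleteSimplex n (k + 1)) (CompleteSimplex n k) ℝ :=
  fun s t =>
    if t.1 ⊆ s.1 then
      ∑ a ∈ s.1 \ t.1, (-1 : ℝ) ^ (s.1.filter (fun b => b < a)).card
    else 0

namespace TorsionAux

/-- sign -/
def sg {n : ℕ} (s : Finset (Fin n)) (a : Fin n) : ℝ :=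
  (-1 : ℝ) ^ (s.filter (fun b => b < a)).card

lemma sg_mul_self {n : ℕ} (s : Finset (Fin n)) (a : Fin n) : sg s a * sg s a = 1 := by
  unfold sg
  rw [← mul_pow]; norm_num

lemma sg_insert {n : ℕ} (s : Finset (Fin n)) (a b : Fin n) (h : a ∉ s) :
    sg (insert a s) b = (if a < b then -1 else 1) * sg s b := by
  unfold sg
  rw [Finset.filter_insert]
  split_ifs with h1
  · rw [Finset.card_insert_of_notMem (by simp [h]), pow_succ]; ring
  · ring

lemma sg_erase {n : ℕ} (s : Finset (Fin n)) (a b : Fin n) (h : a ∈ s) :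
    sg (s.erase a) b = (if a < b then -1 else 1) * sg s b := by
  have := sg_insert (s.erase a) a b (by simp)
  rw [Finset.insert_erase h] at this
  rw [this]; split_ifs <;> ring

/-- exterior derivative on all functions -/
def dd {n : ℕ} (f : Finset (Fin n) → ℝ) (s : Finset (Fin n)) : ℝ :=
  ∑ a ∈ s, sg s a * f (s.erase a)

/-- adjoint -/
def ds {n : ℕ} (f : Finset (Fin n) → ℝ) (t : Finset (Fin n)) : ℝ :=
  ∑ a ∈ tᶜ, sg t a * f (insert a t)

lemma sg_insert_self {n : ℕ} (s : Finset (Fin n)) (a : Fin n) :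
    sg (insert a s) a = sg s a := by
  unfold sg; rw [Finset.filter_insert]; simp

lemma sg_erase_self {n : ℕ} (s : Finset (Fin n)) (a : Fin n) :
    sg (s.erase a) a = sg s a := by
  by_cases h : a ∈ s
  · rw [sg_erase s a a h]; simp
  · rw [Finset.erase_eq_of_notMem h]

lemma dd_dd {n : ℕ} (f : Finset (Fin n) → ℝ) (s : Finset (Fin n)) : dd (dd f) s = 0 := by
  unfold dd
  simp only [Finset.mul_sum]
  have key : ∑ a ∈ s, ∑ b ∈ s.erase a, sg s a * (sg (s.erase a) b * f ((s.erase a).erase b)) =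
     - ∑ a ∈ s, ∑ b ∈ s.erase a, sg s a * (sg (s.erase a) b * f ((s.erase a).erase b)) := by
    conv_lhs => rw [Finset.sum_comm' (t' := s) (s' := fun b => s.erase b) (by
      intro x y; simp only [Finset.mem_erase]; tauto)]
    rw [← Finset.sum_neg_distrib]
    refine Finset.sum_congr rfl fun a ha => ?_
    rw [← Finset.sum_neg_distrib]
    refine Finset.sum_congr rfl fun b hb => ?_
    rw [Finset.mem_erase] at hb
    rw [sg_erase s a b ha, sg_erase s b a hb.2, Finset.erase_right_comm]
    rcases lt_or_gt_of_ne hb.1 with h | h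
    · simp [h, h.not_gt]; ring
    · simp [h, h.not_gt]; ring
  linarith

lemma ds_dd {n : ℕ} (f : Finset (Fin n) → ℝ) (t : Finset (Fin n)) :
    ds (dd f) t + dd (ds f) t = n * f t := by
  have h1 : ds (dd f) t = (tᶜ.card : ℝ) * f t +
      ∑ a ∈ tᶜ, ∑ b ∈ t, sg t a * (sg (insert a t) b * f ((insert a t).erase b)) := by
    unfold ds dd
    rw [← nsmul_eq_mul, ← Finset.sum_const, ← Finset.sum_add_distrib]
    refine Finset.sum_congr rfl fun a ha => ?_
    have ha' : a ∉ t := by simpa using ha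
    rw [Finset.sum_insert ha', mul_add, ← Finset.mul_sum, sg_insert_self,
      Finset.erase_insert ha', ← mul_assoc, sg_mul_self, one_mul]
  have h2 : dd (ds f) t = (t.card : ℝ) * f t +
      ∑ b ∈ t, ∑ a ∈ tᶜ, sg t b * (sg (t.erase b) a * f (insert a (t.erase b))) := by
    unfold ds dd
    rw [← nsmul_eq_mul, ← Finset.sum_const, ← Finset.sum_add_distrib]
    refine Finset.sum_congr rfl fun b hb => ?_
    have : (t.erase b)ᶜ = insert b tᶜ := by
      ext x; simp only [Finset.mem_compl, Finset.mem_erase, Finset.mem_insert]; tauto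
    beta_reduce
    rw [this, Finset.sum_insert (by simpa using hb), mul_add, ← Finset.mul_sum, sg_erase_self,
      Finset.insert_erase hb, ← mul_assoc, sg_mul_self, one_mul]
  have h3 : ∑ a ∈ tᶜ, ∑ b ∈ t, sg t a * (sg (insert a t) b * f ((insert a t).erase b)) =
      - ∑ b ∈ t, ∑ a ∈ tᶜ, sg t b * (sg (t.erase b) a * f (insert a (t.erase b))) := by
    rw [Finset.sum_comm, ← Finset.sum_neg_distrib]
    refine Finset.sum_congr rfl fun b hb => ?_
    rw [← Finset.sum_neg_distrib]
    refine Finset.sum_congr rfl fun a ha => ?_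
    have ha' : a ∉ t := by simpa using ha
    have hab : a ≠ b := by rintro rfl; exact ha' hb
    rw [sg_insert t a b ha', sg_erase t b a hb, Finset.erase_insert_of_ne hab]
    rcases lt_or_gt_of_ne hab with h | h
    · simp [h, h.not_gt]; ring
    · simp [h, h.not_gt]; ring
  have h4 : (t.card : ℝ) + (tᶜ.card : ℝ) = n := by
    rw [← Nat.cast_add, Finset.card_add_card_compl, Fintype.card_fin]
  rw [h1, h2, h3, ← h4]; ring

lemma dd_ds_dd {n : ℕ} (f : Finset (Fin n) → ℝ) (t : Finset (Fin n)) :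
    dd (ds (dd f)) t = n * dd f t := by
  have h := ds_dd (dd f) t
  have h0 : dd (dd f) = fun _ => 0 := funext (dd_dd f)
  rw [h0] at h
  simpa [ds] using h

/-- constructor -/
def mkS {n k : ℕ} (s : Finset (Fin n)) (h : s.card = k + 1) : CompleteSimplex n k := ⟨s, h⟩

/-- extension by zero -/
def ex {n k : ℕ} (v : CompleteSimplex n k → ℝ) (s : Finset (Fin n)) : ℝ :=
  if h : s.card = k + 1 then v (mkS s h) else 0

lemma ex_neg {n k : ℕ} (v : CompleteSimplex n k → ℝ) (s : Finset (Fin n))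
    (h : ¬ s.card = k + 1) : ex v s = 0 := dif_neg h

lemma ex_val {n k : ℕ} (v : CompleteSimplex n k → ℝ) (s : CompleteSimplex n k) :
    ex v s.1 = v s := by
  unfold ex; rw [dif_pos s.2]; rfl

lemma ex_eq_sum {n k : ℕ} (v : CompleteSimplex n k → ℝ) (s : Finset (Fin n)) :
    ex v s = ∑ t : CompleteSimplex n k, if s = t.1 then v t else 0 := by
  unfold ex
  split_ifs with h
  · rw [Finset.sum_eq_single (mkS s h)]
    · rw [if_pos]; rfl
    · intro b _ hb
      rw [if_neg]; intro h'; exact hb (Subtype.ext h'.symm)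
    · simp
  · symm; apply Finset.sum_eq_zero
    intro t _
    rw [if_neg]; rintro rfl; exact h t.2

lemma entry1 {n k : ℕ} (s : CompleteSimplex n (k+1)) (t : CompleteSimplex n k) :
    completeD n k s t = ∑ a ∈ s.1, if s.1.erase a = t.1 then sg s.1 a else 0 := by
  unfold completeD
  rw [← Finset.sum_filter]
  split_ifs with h
  · refine Finset.sum_congr ?_ fun _ _ => rfl
    ext a
    simp only [Finset.mem_sdiff, Finset.mem_filter]
    refine and_congr_right fun ha => ?_
    constructor
    · intro hat
      symm
      apply Finset.eq_of_subset_of_card_le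
      · exact Finset.subset_erase.2 ⟨h, hat⟩
      · rw [Finset.card_erase_of_mem ha, s.2, t.2]; simp
    · intro e; rw [← e]; simp
  · symm
    apply Finset.sum_eq_zero
    intro a ha
    rw [Finset.mem_filter] at ha
    exact absurd (ha.2 ▸ Finset.erase_subset _ _) h

lemma entry2 {n k : ℕ} (s : CompleteSimplex n (k+1)) (t : CompleteSimplex n k) :
    completeD n k s t = ∑ a ∈ t.1ᶜ, if insert a t.1 = s.1 then sg t.1 a else 0 := by
  rw [entry1, ← Finset.sum_filter, ← Finset.sum_filter]
  refine Finset.sum_congr ?_ ?_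
  · ext a
    simp only [Finset.mem_filter, Finset.mem_compl]
    constructor
    · rintro ⟨h, e⟩
      rw [← e]; exact ⟨by simp, Finset.insert_erase h⟩
    · rintro ⟨h, e⟩
      rw [← e]; exact ⟨by simp, Finset.erase_insert h⟩
  · intro a ha
    simp only [Finset.mem_filter, Finset.mem_compl] at ha
    rw [← ha.2, sg_insert_self]

lemma D_mulVec {n k : ℕ} (v : CompleteSimplex n k → ℝ) (s : CompleteSimplex n (k+1)) :
    (completeD n k *ᵥ v) s = dd (ex v) s.1 := by
  unfold dd
  simp only [Matrix.mulVec, dotProduct, entry1, ex_eq_sum, Finset.mul_sum, Finset.sum_mul]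
  rw [Finset.sum_comm]
  refine Finset.sum_congr rfl fun a _ => Finset.sum_congr rfl fun t _ => ?_
  split_ifs <;> simp

lemma DT_mulVec {n k : ℕ} (w : CompleteSimplex n (k+1) → ℝ) (t : CompleteSimplex n k) :
    ((completeD n k)ᵀ *ᵥ w) t = ds (ex w) t.1 := by
  unfold ds
  simp only [Matrix.mulVec, dotProduct, Matrix.transpose_apply, entry2, ex_eq_sum,
    Finset.mul_sum, Finset.sum_mul]
  rw [Finset.sum_comm]
  refine Finset.sum_congr rfl fun a _ => Finset.sum_congr rfl fun s _ => ?_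
  split_ifs <;> simp

lemma ex_D {n k : ℕ} (v : CompleteSimplex n k → ℝ) :
    ex (completeD n k *ᵥ v) = dd (ex v) := by
  funext s
  by_cases h : s.card = k + 1 + 1
  · have := ex_val (completeD n k *ᵥ v) (mkS s h)
    rw [D_mulVec] at this; exact this
  · rw [ex_neg _ _ h]; unfold dd; symm
    apply Finset.sum_eq_zero
    intro a ha
    rw [ex_neg, mul_zero]
    intro h'
    have := Finset.card_erase_add_one ha
    omega

lemma ex_DT {n k : ℕ} (w : CompleteSimplex n (k+1) → ℝ) :
    ex ((completeD n k)ᵀ *ᵥ w) = ds (ex w) := by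
  funext t
  by_cases h : t.card = k + 1
  · have := ex_val ((completeD n k)ᵀ *ᵥ w) (mkS t h)
    rw [DT_mulVec] at this; exact this
  · rw [ex_neg _ _ h]; unfold ds; symm
    apply Finset.sum_eq_zero
    intro a ha
    rw [ex_neg, mul_zero]
    intro h'
    rw [Finset.card_insert_of_notMem (by simpa using ha)] at h'
    omega

lemma D_DT_D (n k : ℕ) :
    completeD n k * ((completeD n k)ᵀ * completeD n k) = (n : ℝ) • completeD n k := by
  apply Matrix.ext_of_mulVec_single
  intro i
  funext s
  rw [← Matrix.mulVec_mulVec, ← Matrix.mulVec_mulVec, D_mulVec, ex_DT, ex_D, dd_ds_dd,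
    Matrix.smul_mulVec, Pi.smul_apply, D_mulVec, smul_eq_mul]

lemma A_sq (n k : ℕ) :
    ((completeD n k)ᵀ * completeD n k) * ((completeD n k)ᵀ * completeD n k) =
      (n : ℝ) • ((completeD n k)ᵀ * completeD n k) := by
  rw [Matrix.mul_assoc, D_DT_D, Matrix.mul_smul]

lemma card_CS (n k : ℕ) : Fintype.card (CompleteSimplex n k) = n.choose (k+1) := by
  have := Fintype.card_finset_len (α := Fin n) (k+1)
  rw [Fintype.card_fin] at this
  rw [← this]
  exact Fintype.card_congr (Equiv.refl _)

lemma diag (n k : ℕ) (t : CompleteSimplex n k) :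
    ((completeD n k)ᵀ * completeD n k) t t = (n : ℝ) - (k + 1) := by
  have h : ((completeD n k)ᵀ * completeD n k) t t =
      ((completeD n k)ᵀ *ᵥ (fun s => completeD n k s t)) t := rfl
  rw [h, DT_mulVec]
  unfold ds
  have : ∀ a ∈ t.1ᶜ, sg t.1 a * ex (fun s => completeD n k s t) (insert a t.1) = 1 := by
    intro a ha
    have ha' : a ∉ t.1 := by simpa using ha
    unfold ex
    have hc : (insert a t.1).card = k + 1 + 1 := by
      rw [Finset.card_insert_of_notMem ha', t.2]
    rw [dif_pos hc]
    unfold completeD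
    change sg t.1 a * (if t.1 ⊆ insert a t.1 then
      ∑ c ∈ insert a t.1 \ t.1, sg (insert a t.1) c else 0) = 1
    rw [if_pos (Finset.subset_insert _ _)]
    have : insert a t.1 \ t.1 = {a} := by
      ext x; simp only [Finset.mem_sdiff, Finset.mem_insert, Finset.mem_singleton]
      constructor
      · tauto
      · rintro rfl; tauto
    rw [this, Finset.sum_singleton]
    rw [sg_insert_self, sg_mul_self]
  rw [Finset.sum_congr rfl this]
  have h4 : (t.1.card : ℝ) + (t.1ᶜ.card : ℝ) = n := by
    rw [← Nat.cast_add, Finset.card_add_card_compl, Fintype.card_fin]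
  rw [t.2] at h4
  push_cast at h4
  simp only [Finset.sum_const, nsmul_eq_mul, mul_one]
  linarith

lemma trace_A (n k : ℕ) (hn : 1 ≤ n) :
    ((completeD n k)ᵀ * completeD n k).trace = (n : ℝ) * (n-1).choose (k+1) := by
  unfold Matrix.trace
  simp only [Matrix.diag_apply, diag, Finset.sum_const, nsmul_eq_mul, Finset.card_univ, card_CS]
  obtain ⟨m, rfl⟩ : ∃ m, n = m + 1 := ⟨n - 1, by omega⟩
  have h1 := Nat.add_one_mul_choose_eq m k
  have h2 := Nat.choose_succ_succ m k
  have h1' : ((m:ℝ)+1) * m.choose k = (m+1).choose (k+1) * (k+1) := by exact_mod_cast h1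
  have h2' : ((m+1).choose (k+1) : ℝ) = m.choose k + m.choose (k+1) := by exact_mod_cast h2
  simp only [Nat.add_sub_cancel]
  push_cast
  linear_combination ((m:ℝ)+1) * h2' + h1'

lemma pseudoDet_eq {V : Type*} [Fintype V] [DecidableEq V] (A : Matrix V V ℝ)
    (hA : A.IsHermitian) (c : ℝ) (hc : c ≠ 0) (h2 : A * A = c • A) (r : ℕ)
    (ht : A.trace = c * r) : pseudoDet A = c ^ r := by
  have hev : ∀ i, hA.eigenvalues i = 0 ∨ hA.eigenvalues i = c := by
    intro i
    have e := hA.mulVec_eigenvectorBasis i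
    set v : V → ℝ := ⇑(hA.eigenvectorBasis i) with hv
    have hv0 : v ≠ 0 := by
      intro h
      apply hA.eigenvectorBasis.orthonormal.ne_zero i
      ext x
      exact congrFun h x
    have e2 : (A * A) *ᵥ v = c • (A *ᵥ v) := by rw [h2, Matrix.smul_mulVec]
    rw [← Matrix.mulVec_mulVec, e, Matrix.mulVec_smul, e, smul_smul, smul_smul, ← sub_eq_zero,
      ← sub_smul, smul_eq_zero] at e2
    have e3 := e2.resolve_right hv0
    have : hA.eigenvalues i * (hA.eigenvalues i - c) = 0 := by linear_combination e3
    rcases mul_eq_zero.1 this with h | h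
    · exact Or.inl h
    · exact Or.inr (sub_eq_zero.1 h)
  have hrk : A.rank = (Finset.univ.filter fun i => hA.eigenvalues i ≠ 0).card := by
    rw [hA.rank_eq_card_non_zero_eigs, Fintype.card_subtype]
  have htr : A.trace = c * A.rank := by
    rw [hA.trace_eq_sum_eigenvalues, hrk, ← Finset.sum_filter_ne_zero,
      Finset.sum_congr rfl (g := fun _ => c)]
    · simp [mul_comm]
    · intro i hi
      rw [Finset.mem_filter] at hi
      exact (hev i).resolve_left hi.2
  have hr : A.rank = r := by
    rw [ht] at htr
    exact_mod_cast (mul_left_cancel₀ hc htr).symm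
  have hle : A.rank ≤ Fintype.card V := Matrix.rank_le_card_width A
  have hcp : A.charpoly = (Polynomial.X - Polynomial.C c) ^ A.rank *
      Polynomial.X ^ (Fintype.card V - A.rank) := by
    rw [hA.charpoly_eq, ← Finset.prod_filter_mul_prod_filter_not Finset.univ
      (fun i => hA.eigenvalues i ≠ 0)]
    congr 1
    · rw [hrk, ← Finset.prod_const]
      refine Finset.prod_congr rfl fun i hi => ?_
      rw [Finset.mem_filter] at hi
      rw [(hev i).resolve_left hi.2]; rfl
    · have : Fintype.card V - A.rank =
          (Finset.univ.filter fun i => ¬ hA.eigenvalues i ≠ 0).card := by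
        have := Finset.card_filter_add_card_filter_not (s := (Finset.univ : Finset V))
          (fun i => hA.eigenvalues i ≠ 0)
        rw [Finset.card_univ] at this
        omega
      rw [this, ← Finset.prod_const]
      refine Finset.prod_congr rfl fun i hi => ?_
      rw [Finset.mem_filter, not_not] at hi
      rw [hi.2]; simp
  unfold pseudoDet
  rw [hcp]
  have := Polynomial.coeff_mul_X_pow ((Polynomial.X - Polynomial.C c) ^ A.rank)
    (Fintype.card V - A.rank) 0
  rw [zero_add] at this
  rw [this, Polynomial.coeff_zero_eq_eval_zero, hr, Polynomial.eval_pow, ← mul_pow]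
  simp

lemma pd (n k : ℕ) (hn : 1 ≤ n) :
    pseudoDet ((completeD n k)ᵀ * completeD n k) = (n : ℝ) ^ ((n-1).choose (k+1)) := by
  apply pseudoDet_eq
  · have := Matrix.isHermitian_conjTranspose_mul_self (completeD n k)
    rwa [Matrix.conjTranspose_eq_transpose_of_trivial] at this
  · have : n ≠ 0 := by omega
    exact_mod_cast this
  · exact A_sq n k
  · exact trace_A n k hn

lemma alt_sum (n : ℕ) (hn : 2 ≤ n) :
    ∑ k ∈ Finset.range n, ((n-1).choose (k+1) : ℤ) * (-1) ^ k = 1 := by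
  have h := Int.alternating_sum_range_choose_of_ne (n := n - 1) (by omega)
  have h1 : n - 1 + 1 = n := by omega
  rw [h1] at h
  have h2 := Finset.sum_range_succ (fun k => (-1:ℤ) ^ k * ((n-1).choose k : ℤ)) n
  rw [h, Nat.choose_eq_zero_of_lt (show n - 1 < n by omega), Finset.sum_range_succ'] at h2
  have h3 : ∑ k ∈ Finset.range n, ((n-1).choose (k+1) : ℤ) * (-1) ^ k =
      - ∑ k ∈ Finset.range n, (-1:ℤ) ^ (k+1) * ((n-1).choose (k+1) : ℤ) := by
    rw [← Finset.sum_neg_distrib]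
    refine Finset.sum_congr rfl fun k _ => ?_
    ring
  rw [h3]
  simp at h2
  linarith

lemma prod_zpow_sum (x : ℝ) (hx : x ≠ 0) (s : Finset ℕ) (f : ℕ → ℤ) :
    ∏ k ∈ s, x ^ f k = x ^ ∑ k ∈ s, f k := by
  induction s using Finset.induction_on with
  | empty => simp
  | insert a s ha ih => rw [Finset.prod_insert ha, Finset.sum_insert ha, zpow_add₀ hx, ih]

end TorsionAux

/-- for the complete graph `K n` with `n ≥ 1`, the squared
analytic torsion `A(K_n) = ∏_k Det(D_k)^{(-1)^k}` (with `D_k = d_kᵀ d_k` the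
Dirac blocks of the Whitney complex of `K n`) equals `n`. -/
theorem torsion_completeGraph (n : ℕ) (hn : 1 ≤ n) :
    ∏ k ∈ Finset.range n,
      pseudoDet ((completeD n k)ᵀ * completeD n k) ^ ((-1 : ℤ) ^ k) = (n : ℝ) := by
  have hn0 : (n : ℝ) ≠ 0 := by
    have : n ≠ 0 := by omega
    exact_mod_cast this
  have h : ∀ k ∈ Finset.range n,
      pseudoDet ((completeD n k)ᵀ * completeD n k) ^ ((-1 : ℤ) ^ k) =
        (n : ℝ) ^ (((n-1).choose (k+1) : ℤ) * (-1) ^ k) := by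
    intro k _
    rw [TorsionAux.pd n k hn, _root_.zpow_mul, zpow_natCast]
  rw [Finset.prod_congr rfl h]
  rcases Nat.lt_or_ge n 2 with h2 | h2
  · obtain rfl : n = 1 := by omega
    simp
  · rw [TorsionAux.prod_zpow_sum _ hn0, TorsionAux.alt_sum n h2, zpow_one]
end
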